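/- Assume the continuum hypothesis. Then there exist two downward-closed subsets X, Y of [ω]^ω, each of positive outer measure with respect to the uniform product measure on 2^ω, such that X ∩ Y has measure zero (is contained in a Borel set of measure zero). -/

import Mathlib

open Set Cardinal MeasureTheory

/-- The characteristic function of a set of naturals, as a point of Cantor space `2^ω`. -/
noncomputable def chi (x : Set ℕ) : ℕ → Bool := fun n => @decide (n ∈ x) (Classical.dec _)

/-- `[ω]^ω`: the collection of infinite subsets of ω. -/
def InfSets : Set (Set ℕ) := {x : Set ℕ | x.Infinite}

/-- `X ⊆ [ω]^ω` is downward closed for almost-inclusion `x ≤ y ↔ (x \ y).Finite`. -/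
def DownClosed (X : Set (Set ℕ)) : Prop :=
  ∀ y ∈ X, ∀ x : Set ℕ, x.Infinite → (x \ y).Finite → x ∈ X

/-- `X` is meager as a subset of Cantor space `2^ω` (product topology on `ℕ → Bool`). -/
def MeagerSet (X : Set (Set ℕ)) : Prop := IsMeagre (chi '' X)

/-- A partition of ω into consecutive finite intervals `I n = [e n, e (n+1))`. -/
structure IntervalPartition where
  e : ℕ → ℕ
  zero : e 0 = 0
  mono : StrictMono e

/-- The `n`-th interval of an interval partition. -/
def IntervalPartition.I (P : IntervalPartition) (n : ℕ) : Set ℕ :=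
  Set.Ico (P.e n) (P.e (n + 1))

/-- `X ⊆ [ω]^ω` is groupwise dense: downward closed, and for every partition of ω into
finite intervals, the union of some infinitely many of the intervals belongs to `X`. -/
def GroupwiseDense (X : Set (Set ℕ)) : Prop :=
  X ⊆ InfSets ∧ DownClosed X ∧
    ∀ P : IntervalPartition, ∃ A : Set ℕ, A.Infinite ∧ (⋃ n ∈ A, P.I n) ∈ X

/-- `g` eventually majorizes `f`. -/
def EvMaj (f g : ℕ → ℕ) : Prop := ∀ᶠ k in Filter.atTop, f k ≤ g k

/-- `M(Π)`: the infinite subsets of ω including only finitely many intervals of `Π`. -/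
def MSet (P : IntervalPartition) : Set (Set ℕ) :=
  {x : Set ℕ | x.Infinite ∧ {n : ℕ | P.I n ⊆ x}.Finite}

/-- The index `n` of the interval `I n` of `P` containing `k`. -/
def idx (P : IntervalPartition) (k : ℕ) : ℕ := Nat.findGreatest (fun n => P.e n ≤ k) k

/-- `F_Π(k)`: the largest element of `I (n+2)`, where `k ∈ I n`. -/
def FPart (P : IntervalPartition) (k : ℕ) : ℕ := P.e (idx P k + 3) - 1

/-- The groupwise density number 𝔤. -/
noncomputable def gNum : Cardinal :=
  sInf {c : Cardinal | ∃ S : Set (Set (Set ℕ)), (∀ G ∈ S, GroupwiseDense G) ∧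
    #S = c ∧ InfSets ∩ ⋂₀ S = ∅}

/-- The bounding number 𝔟. -/
noncomputable def bNum : Cardinal :=
  sInf {c : Cardinal | ∃ F : Set (ℕ → ℕ), #F = c ∧ ∀ g : ℕ → ℕ, ∃ f ∈ F, ¬ EvMaj f g}

/-- The dominating number 𝔡. -/
noncomputable def dNum : Cardinal :=
  sInf {c : Cardinal | ∃ F : Set (ℕ → ℕ), #F = c ∧ ∀ g : ℕ → ℕ, ∃ f ∈ F, EvMaj g f}

/-- `B_M`: the ideal of meager downward-closed subsets of `[ω]^ω`. -/
def BM : Set (Set (Set ℕ)) := {X : Set (Set ℕ) | X ⊆ InfSets ∧ DownClosed X ∧ MeagerSet X}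

/-- `add(B_M)`. -/
noncomputable def addBM : Cardinal :=
  sInf {c : Cardinal | ∃ S : Set (Set (Set ℕ)), S ⊆ BM ∧ #S = c ∧ ⋃₀ S ∉ BM}

/-- `cov(B_M)`. -/
noncomputable def covBM : Cardinal :=
  sInf {c : Cardinal | ∃ S : Set (Set (Set ℕ)), S ⊆ BM ∧ #S = c ∧
    {x : Set ℕ | x.Infinite ∧ xᶜ.Infinite} ⊆ ⋃₀ S}

/-- `unif(B_M)`. -/
noncomputable def unifBM : Cardinal :=
  sInf {c : Cardinal | ∃ S : Set (Set ℕ), (∀ x ∈ S, x.Infinite ∧ xᶜ.Infinite) ∧ #S = c ∧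
    ∀ X ∈ BM, ¬ S ⊆ X}

/-- `cof(B_M)`. -/
noncomputable def cofBM : Cardinal :=
  sInf {c : Cardinal | ∃ C : Set (Set (Set ℕ)), C ⊆ BM ∧ #C = c ∧
    ∀ X ∈ BM, ∃ Y ∈ C, X ⊆ Y}

/-- `X ⊆ [ω]^ω` is dense: every infinite `A` has an infinite subset `B ∈ X`. -/
def DenseM (X : Set (Set ℕ)) : Prop :=
  ∀ A : Set ℕ, A.Infinite → ∃ B ⊆ A, B.Infinite ∧ B ∈ X

/-- 𝔤′: the least number of non-meager downward-closed ideals on ω with empty intersection. -/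
noncomputable def gNum' : Cardinal :=
  sInf {c : Cardinal | ∃ S : Set (Set (Set ℕ)),
    (∀ X ∈ S, X ⊆ InfSets ∧ DownClosed X ∧ (∀ x ∈ X, ∀ y ∈ X, x ∪ y ∈ X) ∧ ¬ MeagerSet X) ∧
    #S = c ∧ InfSets ∩ ⋂₀ S = ∅}

/-- The splitting number 𝔰. -/
noncomputable def sNum : Cardinal :=
  sInf {c : Cardinal | ∃ S : Set (Set ℕ), #S = c ∧
    ∀ x : Set ℕ, x.Infinite → ∃ y ∈ S, (x ∩ y).Infinite ∧ (x \ y).Infinite}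

/-- The `n`-th of a sequence of pairwise disjoint finite sets of size `2 * log₂ n`. -/
def logBlock (n : ℕ) : Finset ℕ :=
  (Finset.range (2 * Nat.log 2 n)).map ⟨Nat.pair n, fun _ _ h => (Nat.pair_eq_pair.1 h).2⟩

lemma card_logBlock (n : ℕ) : (logBlock n).card = 2 * Nat.log 2 n := by
  simp [logBlock]

lemma unpair_fst_of_mem_logBlock {n i : ℕ} (h : i ∈ logBlock n) : i.unpair.1 = n := by
  obtain ⟨a, -, rfl⟩ := Finset.mem_map.1 h
  exact congrArg Prod.fst (Nat.unpair_pair n a)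

lemma disjoint_logBlock {m n : ℕ} (h : m ≠ n) : Disjoint (logBlock m) (logBlock n) :=
  Finset.disjoint_left.2 fun _ hm hn =>
    h ((unpair_fst_of_mem_logBlock hm).symm.trans (unpair_fst_of_mem_logBlock hn))

/-- The sequences which vanish on infinitely many of the sets `logBlock n`. -/
def MissesBlocks (f : ℕ → Bool) : Prop :=
  ∃ᶠ n in Filter.atTop, ∀ i ∈ logBlock n, f i = false

lemma MissesBlocks.of_finite_diff {f g : ℕ → Bool} (hf : MissesBlocks f)
    (h : {i | g i = true ∧ f i = false}.Finite) : MissesBlocks g := by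
  obtain ⟨N, hN⟩ := (h.image fun i => i.unpair.1).bddAbove
  refine (hf.and_eventually (Filter.eventually_gt_atTop N)).mono ?_
  rintro n ⟨hn, hlt⟩ i hi
  by_contra hg
  have := hN ⟨i, ⟨by simpa using hg, hn i hi⟩, rfl⟩
  simp only [unpair_fst_of_mem_logBlock hi] at this
  omega

lemma tsum_half_pow_logBlock_ne_top :
    ∑' n, (1 / 2 : ENNReal) ^ (logBlock n).card ≠ ⊤ := by
  have hs : Summable fun n : ℕ => (4 : ℝ) * (1 / (n : ℝ) ^ 2) :=
    (Real.summable_one_div_nat_pow.2 one_lt_two).mul_left 4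
  have hs' : Summable fun n : ℕ => (1 / 2 : ℝ) ^ (logBlock n).card := by
    refine (summable_nat_add_iff 1).1
      (((summable_nat_add_iff 1).2 hs).of_nonneg_of_le (fun n => by positivity) fun n => ?_)
    rw [card_logBlock]
    have h : ((n + 1 : ℕ) : ℝ) ≤ 2 * 2 ^ Nat.log 2 (n + 1) := by
      have := (Nat.lt_pow_succ_log_self one_lt_two (n + 1)).le
      rw [pow_succ, mul_comm] at this
      exact_mod_cast this
    have hp : (0 : ℝ) < ((n + 1 : ℕ) : ℝ) := by positivity
    rw [mul_comm 2, pow_mul, one_div_pow, one_div_pow, mul_one_div,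
      div_le_div_iff₀ (by positivity) (by positivity)]
    nlinarith
  have h2 : (1 / 2 : ENNReal) = ENNReal.ofReal (1 / 2) := by
    rw [ENNReal.ofReal_div_of_pos two_pos]; simp
  simp_rw [h2, ← ENNReal.ofReal_pow (by norm_num : (0 : ℝ) ≤ 1 / 2)]
  exact hs'.tsum_ofReal_ne_top

lemma tsum_three_quarters_pow_logBlock :
    ∑' n, (3 / 4 : ENNReal) ^ (logBlock n).card = ⊤ := by
  by_contra hne
  have h := ENNReal.summable_toReal hne
  refine Real.not_summable_one_div_natCast ((summable_nat_add_iff 1).1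
    (((summable_nat_add_iff 1).2 h).of_nonneg_of_le (fun n => by positivity) fun n => ?_))
  rw [card_logBlock, ENNReal.toReal_pow, ENNReal.toReal_div, pow_mul]
  have hl : ((2 : ℝ) ^ Nat.log 2 (n + 1)) ≤ ((n + 1 : ℕ) : ℝ) := by
    exact_mod_cast Nat.pow_log_le_self 2 n.succ_ne_zero
  calc 1 / ((n + 1 : ℕ) : ℝ) ≤ 1 / 2 ^ Nat.log 2 (n + 1) :=
        one_div_le_one_div_of_le (by positivity) hl
    _ = (1 / 2) ^ Nat.log 2 (n + 1) := by rw [one_div_pow]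
    _ ≤ _ := by
        refine pow_le_pow_left₀ (by norm_num) ?_ _
        norm_num

section CoinMeasure

variable {μ : Measure (ℕ → Bool)}

lemma measurableSet_cylinder_bool (s : Finset ℕ) (f : ℕ → Bool) :
    MeasurableSet {y : ℕ → Bool | ∀ n ∈ s, y n = f n} := by
  have : {y : ℕ → Bool | ∀ n ∈ s, y n = f n} = ⋂ n ∈ s, (fun y : ℕ → Bool => y n) ⁻¹' {f n} := by
    ext; simp
  rw [this]
  exact Finset.measurableSet_biInter _ fun n _ => measurable_pi_apply n (measurableSet_singleton _)

lemma isProbabilityMeasure_of_cylinder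
    (hμ : ∀ (s : Finset ℕ) (f : ℕ → Bool),
      μ {y : ℕ → Bool | ∀ n ∈ s, y n = f n} = (1 / 2) ^ s.card) :
    IsProbabilityMeasure μ :=
  ⟨by simpa using hμ ∅ fun _ => false⟩

lemma nullSingletonClass_of_cylinder
    (hμ : ∀ (s : Finset ℕ) (f : ℕ → Bool),
      μ {y : ℕ → Bool | ∀ n ∈ s, y n = f n} = (1 / 2) ^ s.card) :
    NullSingletonClass μ := by
  refine ⟨fun f => le_antisymm (ge_of_tendsto'
    (ENNReal.tendsto_pow_atTop_nhds_zero_of_lt_one (r := 1 / 2) (by simp)) fun n => ?_) bot_le⟩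
  calc μ {f} ≤ μ {y | ∀ i ∈ Finset.range n, y i = f i} :=
        measure_mono (by rintro _ rfl; simp)
    _ = (1 / 2) ^ n := by rw [hμ, Finset.card_range]

lemma measure_missesBlocks
    (hμ : ∀ (s : Finset ℕ) (f : ℕ → Bool),
      μ {y : ℕ → Bool | ∀ n ∈ s, y n = f n} = (1 / 2) ^ s.card) :
    μ {f | MissesBlocks f} = 0 := by
  refine measure_setOfPred_frequently_eq_zero ?_
  simp_rw [hμ _ fun _ => false]
  exact tsum_half_pow_logBlock_ne_top

/-- The pairs of subsets of `ω` whose intersection misses `J`. -/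
def disjointOn (J : Finset ℕ) : Set ((ℕ → Bool) × (ℕ → Bool)) :=
  {p | ∀ i ∈ J, (p.1 i && p.2 i) = false}

lemma disjointOn_eq_biUnion (J : Finset ℕ) :
    disjointOn J = ⋃ t ∈ J.powerset,
      {x : ℕ → Bool | ∀ n ∈ t, x n = (fun _ => false) n} ×ˢ
        {y : ℕ → Bool | ∀ n ∈ J, y n = (fun i => decide (i ∈ t)) n} := by
  ext ⟨x, y⟩
  simp only [disjointOn, mem_ofPred_eq, mem_iUnion, mem_prod, Finset.mem_powerset, exists_prop]
  constructor
  · intro h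
    refine ⟨J.filter fun i => y i = true, Finset.filter_subset _ _, fun n hn => ?_, fun n hn => ?_⟩
    · rw [Finset.mem_filter] at hn
      simpa [hn.2] using h n hn.1
    · by_cases hy : y n = true <;> simp [hn, hy]
  · rintro ⟨t, -, hx, hy⟩ i hi
    by_cases hit : i ∈ t
    · simp [hx i hit]
    · simp [hy i hi, hit]

lemma measurableSet_disjointOn (J : Finset ℕ) : MeasurableSet (disjointOn J) := by
  rw [disjointOn_eq_biUnion]
  exact Finset.measurableSet_biUnion _ fun t _ =>
    (measurableSet_cylinder_bool _ _).prod (measurableSet_cylinder_bool _ _)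

lemma measure_disjointOn
    (hμ : ∀ (s : Finset ℕ) (f : ℕ → Bool),
      μ {y : ℕ → Bool | ∀ n ∈ s, y n = f n} = (1 / 2) ^ s.card) (J : Finset ℕ) :
    (μ.prod μ) (disjointOn J) = (3 / 4) ^ J.card := by
  have := isProbabilityMeasure_of_cylinder hμ
  rw [disjointOn_eq_biUnion, measure_biUnion_finset]
  · simp_rw [Measure.prod_prod, hμ, ← Finset.sum_mul]
    have := Finset.sum_pow_mul_eq_add_pow (1 / 2 : ENNReal) 1 J
    simp only [one_pow, mul_one] at this
    rw [this, ← mul_pow]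
    congr 1
    rw [← ENNReal.toReal_eq_toReal_iff' (by finiteness) (by finiteness), ENNReal.toReal_mul,
      ENNReal.toReal_add (by finiteness) (by finiteness)]
    norm_num
  · intro t ht t' ht' hne
    refine Set.disjoint_left.2 ?_
    rintro ⟨x, y⟩ ⟨-, h1⟩ ⟨-, h2⟩
    refine hne (Finset.ext fun i => ?_)
    simp only [Finset.coe_powerset, mem_preimage, mem_powerset_iff, Finset.coe_subset] at ht ht'
    constructor
    · intro hi
      simpa [hi] using (h1 i (ht hi)).symm.trans (h2 i (ht hi))
    · intro hi
      simpa [hi] using (h1 i (ht' hi)).symm.trans (h2 i (ht' hi))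
  · exact fun t _ => (measurableSet_cylinder_bool _ _).prod (measurableSet_cylinder_bool _ _)

lemma ae_missesBlocks_and
    (hμ : ∀ (s : Finset ℕ) (f : ℕ → Bool),
      μ {y : ℕ → Bool | ∀ n ∈ s, y n = f n} = (1 / 2) ^ s.card) :
    ∀ᵐ x ∂μ, ∀ᵐ y ∂μ, MissesBlocks fun i => x i && y i := by
  have := isProbabilityMeasure_of_cylinder hμ
  have hm : ∀ n, MeasurableSet (disjointOn (logBlock n)) := fun n => measurableSet_disjointOn _
  have hind : ProbabilityTheory.iIndepSet (fun n => disjointOn (logBlock n)) (μ.prod μ) := by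
    rw [ProbabilityTheory.iIndepSet_iff_meas_biInter hm]
    intro s
    have hs : ⋂ n ∈ s, disjointOn (logBlock n) = disjointOn (s.biUnion logBlock) := by
      ext p
      simp only [disjointOn, mem_iInter, mem_ofPred_eq, Finset.mem_biUnion]
      exact ⟨fun h i ⟨n, hn, hi⟩ => h n hn i hi, fun h n hn i hi => h i ⟨n, hn, hi⟩⟩
    rw [hs, measure_disjointOn hμ, Finset.card_biUnion fun m _ n _ h => disjoint_logBlock h]
    simp_rw [measure_disjointOn hμ, Finset.prod_pow_eq_pow_sum]
  have hone := ProbabilityTheory.measure_limsup_eq_one hm hind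
    (by simp_rw [measure_disjointOn hμ]; exact tsum_three_quarters_pow_logBlock)
  have hae : ∀ᵐ p ∂μ.prod μ, p ∈ Filter.limsup (fun n => disjointOn (logBlock n)) Filter.atTop :=
    (prob_compl_eq_zero_iff (MeasurableSet.measurableSet_limsup hm)).2 hone
  refine Measure.ae_ae_of_ae_prod
    (p := fun p : (ℕ → Bool) × (ℕ → Bool) => MissesBlocks fun i => p.1 i && p.2 i) ?_
  filter_upwards [hae] with p hp
  exact Filter.mem_limsup_iff_frequently_mem.1 hp

end CoinMeasure

/-- If, for every requirement `w` and every countable set `S`, some point meets `w` and is related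
to all members of `S`, then at most `ℵ₁` requirements can be met by pairwise related points. -/
lemma exists_pairwise_of_card_le_aleph_one {W T : Type*} (hW : #W ≤ aleph 1)
    (P : W → T → Prop) (R : T → T → Prop) (hR : ∀ s t, R s t → R t s)
    (h : ∀ w, ∀ S : Set T, S.Countable → ∃ t, P w t ∧ ∀ s ∈ S, R s t) :
    ∃ z : W → T, (∀ w, P w (z w)) ∧ ∀ v w, v ≠ w → R (z v) (z w) := by
  obtain ⟨r, hwo, hr⟩ := Cardinal.exists_ord_eq W
  have hc : ∀ w, {v | r v w}.Countable := by
    intro w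
    have hlt : #{v // r v w} < aleph 1 := by
      have := Ordinal.typein_lt_type r w
      rw [← hr, lt_ord] at this
      exact this.trans_le hW
    exact le_aleph0_iff_set_countable.1 (lt_aleph_one_iff.1 hlt)
  choose F hP hF using fun w (S : {S : Set T // S.Countable}) => h w S S.2
  have hcr : ∀ w (g : {v // r v w} → T), (range g).Countable := fun w g =>
    have : Countable {v // r v w} := (hc w).to_subtype
    countable_range g
  let z : W → T := hwo.wf.fix fun w ih => F w ⟨range fun v : {v // r v w} => ih v v.2, hcr w _⟩
  have hz : ∀ w, z w = F w ⟨range fun v : {v // r v w} => z v, hcr w _⟩ :=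
    fun w => hwo.wf.fix_eq _ w
  have hlt : ∀ v w, r v w → R (z v) (z w) := fun v w hvw => by
    rw [hz w]
    exact hF w _ _ ⟨⟨v, hvw⟩, rfl⟩
  refine ⟨z, fun w => ?_, fun v w hvw => ?_⟩
  · rw [hz w]
    exact hP w _
  · rcases trichotomous_of r v w with h | h | h
    · exact hlt v w h
    · exact absurd h hvw
    · exact hR _ _ (hlt w v h)

lemma mk_measurableSet_le_continuum (α : Type*) [m : MeasurableSpace α]
    [MeasurableSpace.CountablyGenerated α] : #{s : Set α // MeasurableSet s} ≤ continuum := by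
  obtain ⟨b, hb, rfl⟩ := MeasurableSpace.CountablyGenerated.isCountablyGenerated (α := α)
  exact MeasurableSpace.cardinal_measurableSet_le_continuum
    ((le_aleph0_iff_set_countable.2 hb).trans aleph0_le_continuum)

lemma chi_apply_eq_true {x : Set ℕ} {n : ℕ} : chi x n = true ↔ n ∈ x := by
  simp [chi]

lemma chi_setOf_eq_true (f : ℕ → Bool) : chi {n | f n = true} = f := by
  funext n
  simp [chi]

/-- Theorem 6: assuming CH, for the uniform product measure `μ` on `2^ω` there are
downward-closed `X, Y ⊆ [ω]^ω` of positive outer measure with `X ∩ Y` of measure zero. -/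
theorem stmt15 (hCH : Cardinal.continuum = Cardinal.aleph 1)
    (μ : Measure (ℕ → Bool))
    (hμ : ∀ (s : Finset ℕ) (f : ℕ → Bool),
      μ {y : ℕ → Bool | ∀ n ∈ s, y n = f n} = (1 / 2) ^ s.card) :
    ∃ X Y : Set (Set ℕ), X ⊆ InfSets ∧ Y ⊆ InfSets ∧ DownClosed X ∧ DownClosed Y ∧
      μ (chi '' X) ≠ 0 ∧ μ (chi '' Y) ≠ 0 ∧ μ (chi '' (X ∩ Y)) = 0 := by
  have := isProbabilityMeasure_of_cylinder hμ
  have := nullSingletonClass_of_cylinder hμ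
  let A : Set (ℕ → Bool) := {x | ∀ᵐ y ∂μ, MissesBlocks fun i => x i && y i}
  have hfin : ∀ᵐ y ∂μ, {n | y n = true}.Infinite := by
    have hc : (chi '' {s : Set ℕ | s.Finite}).Countable :=
      Set.Countable.image Set.Countable.ofPred_finite _
    filter_upwards [compl_mem_ae_iff.2 (hc.measure_zero μ)] with y hy hf
    exact hy ⟨_, hf, chi_setOf_eq_true y⟩
  let W := {N : {s : Set (ℕ → Bool) // MeasurableSet s} // μ N.1 = 0} × Bool
  have hCH₀ : continuum.{0} = aleph.{0} 1 :=
    lift_injective (by simpa only [lift_continuum, lift_aleph, Ordinal.lift_one] using hCH)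
  have hW : #W ≤ aleph 1 := by
    rw [← hCH₀, mk_prod, lift_id, lift_id]
    refine mul_le_of_le aleph0_le_continuum
      ((mk_subtype_le _).trans (mk_measurableSet_le_continuum _)) ?_
    exact (mk_le_aleph0).trans aleph0_le_continuum
  obtain ⟨z, hz, hR⟩ := exists_pairwise_of_card_le_aleph_one (T := A) hW
    (fun w t => t.1 ∉ w.1.1.1 ∧ {n | t.1 n = true}.Infinite)
    (fun s t => MissesBlocks fun i => s.1 i && t.1 i)
    (fun s t h => by simpa only [Bool.and_comm] using h) (by
      rintro ⟨⟨N, hN⟩, -⟩ S hS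
      have hall : ∀ᵐ y ∂μ, ∀ s ∈ S, MissesBlocks fun i => s.1 i && y i :=
        (ae_ball_iff hS).2 fun s _ => s.2
      have hNae : ∀ᵐ y ∂μ, y ∉ N.1 := compl_mem_ae_iff.2 hN
      obtain ⟨y, hyS, hyA, hyN, hyf⟩ := (hall.and ((ae_missesBlocks_and hμ).and
        (hNae.and hfin))).exists
      exact ⟨⟨y, hyA⟩, ⟨hyN, hyf⟩, hyS⟩)
  let X : Bool → Set (Set ℕ) := fun b =>
    {x | x.Infinite ∧ ∃ N, (x \ {n | (z (N, b)).1 n = true}).Finite}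
  have hdown : ∀ b, DownClosed (X b) := by
    rintro b y ⟨-, N, hy⟩ x hx hxy
    refine ⟨hx, N, (hxy.union hy).subset fun n hn => ?_⟩
    by_cases h : n ∈ y
    · exact Or.inr ⟨h, hn.2⟩
    · exact Or.inl ⟨hn.1, h⟩
  have hpos : ∀ b, μ (chi '' X b) ≠ 0 := by
    intro b h0
    let N : {N : {s : Set (ℕ → Bool) // MeasurableSet s} // μ N.1 = 0} :=
      ⟨⟨toMeasurable μ (chi '' X b), measurableSet_toMeasurable _ _⟩, by
        rw [measure_toMeasurable, h0]⟩
    refine (hz (N, b)).1 (subset_toMeasurable μ _ ?_)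
    exact ⟨_, ⟨(hz (N, b)).2, N, by simp⟩, chi_setOf_eq_true _⟩
  refine ⟨X true, X false, fun x hx => hx.1, fun x hx => hx.1, hdown _, hdown _, hpos _, hpos _,
    measure_mono_null ?_ (measure_missesBlocks hμ)⟩
  rintro _ ⟨x, ⟨⟨-, M, hM⟩, ⟨-, N, hN⟩⟩, rfl⟩
  refine (hR (M, true) (N, false) fun h => Bool.noConfusion (congrArg Prod.snd h)).of_finite_diff
    ((hM.union hN).subset fun n hn => ?_)
  obtain ⟨h1, h2⟩ := hn
  rw [chi_apply_eq_true] at h1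
  rcases Bool.and_eq_false_iff.1 h2 with h | h
  · exact Or.inl ⟨h1, by simp [h]⟩
  · exact Or.inr ⟨h1, by simp [h]⟩
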